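/- Let k ≥ ℓ ≥ 3. Every (k,ℓ)-quadrocrucial permutation has length at least k+2ℓ−5, and the permutation of length k+2ℓ−5 given by (ℓ−1)(ℓ−2)⋯1 · ℓ(ℓ+1)⋯(ℓ+k−4) · (k+2ℓ−5)(k+2ℓ−6)⋯(k+ℓ−3), i.e., the ℓ−1 smallest elements in decreasing order, followed by the k−3 middle elements in increasing order, followed by the ℓ−1 largest elements in decreasing order, is (k,ℓ)-quadrocrucial. Hence the minimal possible length of a (k,ℓ)-quadrocrucial permutation is k+2ℓ−5. -/

import Mathlib

/-- `σ` (in one-line notation, 0-based) has an increasing subsequence of length `k`,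
i.e. contains an occurrence of the pattern `i_k`. -/
def HasIncr (k n : ℕ) (σ : Fin n → Fin n) : Prop :=
  ∃ f : Fin k → Fin n, StrictMono f ∧ StrictMono (σ ∘ f)

/-- `σ` has a decreasing subsequence of length `l`,
i.e. contains an occurrence of the pattern `d_l`. -/
def HasDecr (l n : ℕ) (σ : Fin n → Fin n) : Prop :=
  ∃ f : Fin l → Fin n, StrictMono f ∧ StrictAnti (σ ∘ f)

/-- `σ` contains `i_k` or `d_l`. -/
def ContainsPat (k l n : ℕ) (σ : Fin n → Fin n) : Prop :=
  HasIncr k n σ ∨ HasDecr l n σ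

/-- `σ` avoids both `i_k` and `d_l`. -/
def AvoidsPat (k l n : ℕ) (σ : Fin n → Fin n) : Prop :=
  ¬ HasIncr k n σ ∧ ¬ HasDecr l n σ

/-- The `i`-th extension of `σ` to the right (0-based): append the value `i` at the end,
renaming old values via `Fin.succAbove i` (i.e. `x ↦ x` if `x < i`, `x ↦ x+1` if `x ≥ i`). -/
def rightExt {n : ℕ} (σ : Fin n → Fin n) (i : Fin (n + 1)) : Fin (n + 1) → Fin (n + 1) :=
  Fin.snoc (fun j => i.succAbove (σ j)) i

/-- The `i`-th extension of `σ` to the left: prepend the value `i`. -/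
def leftExt {n : ℕ} (σ : Fin n → Fin n) (i : Fin (n + 1)) : Fin (n + 1) → Fin (n + 1) :=
  Fin.cons i (fun j => i.succAbove (σ j))

/-- The `i`-th extension of `σ` from above: insert the new maximum value at position `i`. -/
def topExt {n : ℕ} (σ : Fin n → Fin n) (i : Fin (n + 1)) : Fin (n + 1) → Fin (n + 1) :=
  i.insertNth (Fin.last n) (fun j => (σ j).castSucc)

/-- The `i`-th extension of `σ` from below: insert the new minimum value at position `i`,
increasing all old values by one. -/
def botExt {n : ℕ} (σ : Fin n → Fin n) (i : Fin (n + 1)) : Fin (n + 1) → Fin (n + 1) :=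
  i.insertNth 0 (fun j => (σ j).succ)

/-- `σ` is `(k,l)`-right-crucial (also called `(k,l)`-crucial): it avoids `i_k` and `d_l`,
but every extension of it to the right contains `i_k` or `d_l`. -/
def RightCrucial (k l n : ℕ) (σ : Fin n → Fin n) : Prop :=
  AvoidsPat k l n σ ∧ ∀ i : Fin (n + 1), ContainsPat k l (n + 1) (rightExt σ i)

/-- `σ` is `(k,l)`-left-crucial. -/
def LeftCrucial (k l n : ℕ) (σ : Fin n → Fin n) : Prop :=
  AvoidsPat k l n σ ∧ ∀ i : Fin (n + 1), ContainsPat k l (n + 1) (leftExt σ i)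

/-- `σ` is `(k,l)`-top-crucial. -/
def TopCrucial (k l n : ℕ) (σ : Fin n → Fin n) : Prop :=
  AvoidsPat k l n σ ∧ ∀ i : Fin (n + 1), ContainsPat k l (n + 1) (topExt σ i)

/-- `σ` is `(k,l)`-bottom-crucial. -/
def BottomCrucial (k l n : ℕ) (σ : Fin n → Fin n) : Prop :=
  AvoidsPat k l n σ ∧ ∀ i : Fin (n + 1), ContainsPat k l (n + 1) (botExt σ i)

/-- `σ` is `(k,l)`-bicrucial: both right-crucial and left-crucial. -/
def Bicrucial (k l n : ℕ) (σ : Fin n → Fin n) : Prop :=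
  RightCrucial k l n σ ∧ LeftCrucial k l n σ

/-- `σ` is `(k,l)`-top-right-crucial: right-crucial and every extension from above
contains `i_k` or `d_l`. -/
def TopRightCrucial (k l n : ℕ) (σ : Fin n → Fin n) : Prop :=
  RightCrucial k l n σ ∧ ∀ i : Fin (n + 1), ContainsPat k l (n + 1) (topExt σ i)

/-- `σ` is `(k,l)`-tricrucial: bicrucial and every extension from above
contains `i_k` or `d_l`. -/
def Tricrucial (k l n : ℕ) (σ : Fin n → Fin n) : Prop :=
  Bicrucial k l n σ ∧ ∀ i : Fin (n + 1), ContainsPat k l (n + 1) (topExt σ i)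

/-- `σ` is `(k,l)`-quadrocrucial: tricrucial and every extension from below
contains `i_k` or `d_l`. -/
def Quadrocrucial (k l n : ℕ) (σ : Fin n → Fin n) : Prop :=
  Tricrucial k l n σ ∧ ∀ i : Fin (n + 1), ContainsPat k l (n + 1) (botExt σ i)

/-- The permutation `(l-1)(l-2)⋯1 · l(l+1)⋯(l+k-4) · (k+2l-5)(k+2l-6)⋯(k+l-3)` of length
`k+2l-5`: the `l-1` smallest elements in decreasing order, then the `k-3` middle elements
in increasing order, then the `l-1` largest elements in decreasing order
(0-based: `j ↦ l-2-j` for `j ≤ l-2`, `j ↦ j` for `l-1 ≤ j ≤ k+l-5`, `j ↦ 2k+3l-10-j` else). -/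
def minQuad (k l : ℕ) (hk : 3 ≤ k) (hl : 3 ≤ l) :
    Fin (k + 2 * l - 5) → Fin (k + 2 * l - 5) :=
  fun j =>
    if h1 : (j : ℕ) ≤ l - 2 then ⟨l - 2 - (j : ℕ), by omega⟩
    else if h2 : (j : ℕ) ≤ k + l - 5 then j
    else ⟨2 * k + 3 * l - 10 - (j : ℕ), by have := j.isLt; omega⟩

def IncS {n : ℕ} (σ : Fin n → Fin n) (S : Finset (Fin n)) : Prop :=
  ∀ x ∈ S, ∀ y ∈ S, x < y → σ x < σ y

def DecS {n : ℕ} (σ : Fin n → Fin n) (S : Finset (Fin n)) : Prop :=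
  ∀ x ∈ S, ∀ y ∈ S, x < y → σ y < σ x

lemma hasIncr_of_set {k n : ℕ} {σ : Fin n → Fin n} {S : Finset (Fin n)} (h : IncS σ S)
    (hc : k ≤ S.card) : HasIncr k n σ := by
  obtain ⟨T, hT, hTc⟩ := Finset.exists_subset_card_eq hc
  refine ⟨T.orderEmbOfFin hTc, (T.orderEmbOfFin hTc).strictMono, fun a b hab => ?_⟩
  exact h _ (hT (T.orderEmbOfFin_mem hTc a)) _ (hT (T.orderEmbOfFin_mem hTc b))
    ((T.orderEmbOfFin hTc).strictMono hab)

lemma hasDecr_of_set {k n : ℕ} {σ : Fin n → Fin n} {S : Finset (Fin n)} (h : DecS σ S)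
    (hc : k ≤ S.card) : HasDecr k n σ := by
  obtain ⟨T, hT, hTc⟩ := Finset.exists_subset_card_eq hc
  refine ⟨T.orderEmbOfFin hTc, (T.orderEmbOfFin hTc).strictMono, fun a b hab => ?_⟩
  exact h _ (hT (T.orderEmbOfFin_mem hTc a)) _ (hT (T.orderEmbOfFin_mem hTc b))
    ((T.orderEmbOfFin hTc).strictMono hab)

lemma set_of_hasIncr {k n : ℕ} {σ : Fin n → Fin n} (h : HasIncr k n σ) :
    ∃ S, IncS σ S ∧ S.card = k := by
  obtain ⟨f, hf, hs⟩ := h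
  refine ⟨Finset.univ.image f, ?_, ?_⟩
  · intro x hx y hy hxy
    simp only [Finset.mem_image, Finset.mem_univ, true_and] at hx hy
    obtain ⟨a, rfl⟩ := hx
    obtain ⟨b, rfl⟩ := hy
    exact hs (hf.lt_iff_lt.1 hxy)
  · rw [Finset.card_image_of_injective _ hf.injective]; simp

lemma set_of_hasDecr {k n : ℕ} {σ : Fin n → Fin n} (h : HasDecr k n σ) :
    ∃ S, DecS σ S ∧ S.card = k := by
  obtain ⟨f, hf, hs⟩ := h
  refine ⟨Finset.univ.image f, ?_, ?_⟩
  · intro x hx y hy hxy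
    simp only [Finset.mem_image, Finset.mem_univ, true_and] at hx hy
    obtain ⟨a, rfl⟩ := hx
    obtain ⟨b, rfl⟩ := hy
    exact hs (hf.lt_iff_lt.1 hxy)
  · rw [Finset.card_image_of_injective _ hf.injective]; simp

lemma restrict_card {n : ℕ} (e : Fin n → Fin (n + 1)) (p : Fin (n + 1))
    (hcov : ∀ x, x ≠ p → ∃ y, e y = x) (T : Finset (Fin (n + 1))) :
    (T.erase p).card ≤ (Finset.univ.filter (fun y => e y ∈ T)).card := by
  classical
  have : T.erase p ⊆ (Finset.univ.filter (fun y => e y ∈ T)).image e := by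
    intro x hx
    obtain ⟨y, rfl⟩ := hcov x (Finset.ne_of_mem_erase hx)
    exact Finset.mem_image_of_mem _ (by simpa using Finset.mem_of_mem_erase hx)
  exact (Finset.card_le_card this).trans Finset.card_image_le

lemma ext_incr {k n : ℕ} {σ : Fin n → Fin n} {τ : Fin (n + 1) → Fin (n + 1)}
    (e : Fin n → Fin (n + 1)) (he : StrictMono e) (p i : Fin (n + 1))
    (hcov : ∀ x, x ≠ p → ∃ y, e y = x) (hτ : ∀ y, τ (e y) = i.succAbove (σ y)) (hp : τ p = i)
    (h : HasIncr k (n + 1) τ) (hn : ¬ HasIncr k n σ) :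
    ∃ S, IncS σ S ∧ k - 1 ≤ S.card ∧
      ∀ y ∈ S, (e y < p → (σ y : ℕ) < i) ∧ (p < e y → (i : ℕ) ≤ σ y) := by
  obtain ⟨T, hT, hc⟩ := set_of_hasIncr h
  have hS := restrict_card e p hcov T
  have hI : IncS σ (Finset.univ.filter (fun y => e y ∈ T)) := by
    intro x hx y hy hxy
    have := hT _ (by simpa using hx) _ (by simpa using hy) (he hxy)
    rw [hτ, hτ] at this
    exact (Fin.strictMono_succAbove i).lt_iff_lt.1 this
  by_cases hpT : p ∈ T
  · refine ⟨_, hI, ?_, ?_⟩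
    · rw [Finset.card_erase_of_mem hpT] at hS; omega
    · intro y hy
      constructor
      · intro hlt
        have := hT _ (by simpa using hy) _ hpT hlt
        rw [hτ, hp, Fin.succAbove_lt_iff_castSucc_lt] at this
        exact this
      · intro hlt
        have := hT _ hpT _ (by simpa using hy) hlt
        rw [hτ, hp, Fin.lt_succAbove_iff_le_castSucc] at this
        exact this
  · rw [Finset.erase_eq_of_notMem hpT] at hS
    exact absurd (hasIncr_of_set hI (hc ▸ hS)) hn

lemma ext_decr {k n : ℕ} {σ : Fin n → Fin n} {τ : Fin (n + 1) → Fin (n + 1)}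
    (e : Fin n → Fin (n + 1)) (he : StrictMono e) (p i : Fin (n + 1))
    (hcov : ∀ x, x ≠ p → ∃ y, e y = x) (hτ : ∀ y, τ (e y) = i.succAbove (σ y)) (hp : τ p = i)
    (h : HasDecr k (n + 1) τ) (hn : ¬ HasDecr k n σ) :
    ∃ S, DecS σ S ∧ k - 1 ≤ S.card ∧
      ∀ y ∈ S, (p < e y → (σ y : ℕ) < i) ∧ (e y < p → (i : ℕ) ≤ σ y) := by
  obtain ⟨T, hT, hc⟩ := set_of_hasDecr h
  have hS := restrict_card e p hcov T
  have hI : DecS σ (Finset.univ.filter (fun y => e y ∈ T)) := by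
    intro x hx y hy hxy
    have := hT _ (by simpa using hx) _ (by simpa using hy) (he hxy)
    rw [hτ, hτ] at this
    exact (Fin.strictMono_succAbove i).lt_iff_lt.1 this
  by_cases hpT : p ∈ T
  · refine ⟨_, hI, ?_, ?_⟩
    · rw [Finset.card_erase_of_mem hpT] at hS; omega
    · intro y hy
      constructor
      · intro hlt
        have := hT _ hpT _ (by simpa using hy) hlt
        rw [hτ, hp, Fin.succAbove_lt_iff_castSucc_lt] at this
        exact this
      · intro hlt
        have := hT _ (by simpa using hy) _ hpT hlt
        rw [hτ, hp, Fin.lt_succAbove_iff_le_castSucc] at this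
        exact this
  · rw [Finset.erase_eq_of_notMem hpT] at hS
    exact absurd (hasDecr_of_set hI (hc ▸ hS)) hn

lemma switch (P Q : ℕ → Prop) (n : ℕ) (h : ∀ i ≤ n, P i ∨ Q i) (h0 : ¬ P 0) (hn : ¬ Q n) :
    ∃ m, P (m + 1) ∧ Q m := by
  classical
  have hP : ∃ i, P i := ⟨n, (h n le_rfl).resolve_right hn⟩
  have h1 := Nat.find_spec hP
  have h2 : Nat.find hP ≤ n := Nat.find_min' hP ((h n le_rfl).resolve_right hn)
  obtain ⟨m, hm⟩ : ∃ m, Nat.find hP = m + 1 :=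
    Nat.exists_eq_succ_of_ne_zero (fun h => h0 (h ▸ h1))
  refine ⟨m, hm ▸ h1, (h m (by omega)).resolve_left (Nat.find_min hP (by omega))⟩

lemma inter_card {n : ℕ} {σ : Fin n → Fin n} {S T : Finset (Fin n)} (hS : IncS σ S)
    (hT : DecS σ T) : (S ∩ T).card ≤ 1 := by
  rw [Finset.card_le_one]
  intro a ha b hb
  rw [Finset.mem_inter] at ha hb
  rcases lt_trichotomy a b with h | h | h
  · exact absurd (hS _ ha.1 _ hb.1 h) (lt_asymm (hT _ ha.2 _ hb.2 h))
  · exact h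
  · exact absurd (hS _ hb.1 _ ha.1 h) (lt_asymm (hT _ hb.2 _ ha.2 h))

lemma three_card {n : ℕ} {A B C : Finset (Fin n)} (hAB : Disjoint A B)
    (hA : (C ∩ A).card ≤ 1) (hB : (C ∩ B).card ≤ 1) : A.card + B.card + C.card ≤ n + 2 := by
  have h1 := Finset.card_union_of_disjoint hAB
  have h2 := Finset.card_union_add_card_inter C (A ∪ B)
  have h3 : (C ∩ (A ∪ B)).card ≤ (C ∩ A).card + (C ∩ B).card := by
    rw [Finset.inter_union_distrib_left]; exact Finset.card_union_le _ _
  have h4 : (C ∪ (A ∪ B)).card ≤ n := by simpa using Finset.card_le_univ (C ∪ (A ∪ B))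
  omega

lemma lower (k l : ℕ) (hl : 3 ≤ l) (hkl : l ≤ k) (n : ℕ) (σ : Fin n → Fin n)
    (hσ : Function.Injective σ) (h : Bicrucial k l n σ) : k + 2 * l - 5 ≤ n := by
  obtain ⟨⟨⟨hi, hd⟩, hr⟩, ⟨-, hlft⟩⟩ := h
  have ne : ∀ {S : Finset (Fin n)} {c : ℕ}, 3 ≤ c → c - 1 ≤ S.card → ∃ x, x ∈ S := by
    intro S c hc hS
    exact Finset.card_pos.1 (by omega)
  obtain ⟨a, ⟨I, hI, hIc, hIa⟩, ⟨D, hD, hDc, hDa⟩⟩ := switch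
    (fun i => ∃ S, IncS σ S ∧ k - 1 ≤ S.card ∧ ∀ y ∈ S, (σ y : ℕ) < i)
    (fun i => ∃ S, DecS σ S ∧ l - 1 ≤ S.card ∧ ∀ y ∈ S, i ≤ (σ y : ℕ)) n
    (by
      intro i hin
      have hcov : ∀ x : Fin (n + 1), x ≠ Fin.last n → ∃ y, Fin.castSucc y = x :=
        fun x hx => Fin.exists_castSucc_eq.2 hx
      rcases hr ⟨i, by omega⟩ with h | h
      · left
        obtain ⟨S, h1, h2, h3⟩ := ext_incr (σ := σ) Fin.castSucc Fin.strictMono_castSucc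
          (Fin.last n) ⟨i, by omega⟩ hcov (by simp [rightExt]) (by simp [rightExt]) h hi
        exact ⟨S, h1, h2, fun y hy => (h3 y hy).1 (Fin.castSucc_lt_last y)⟩
      · right
        obtain ⟨S, h1, h2, h3⟩ := ext_decr (σ := σ) Fin.castSucc Fin.strictMono_castSucc
          (Fin.last n) ⟨i, by omega⟩ hcov (by simp [rightExt]) (by simp [rightExt]) h hd
        exact ⟨S, h1, h2, fun y hy => (h3 y hy).2 (Fin.castSucc_lt_last y)⟩)
    (by
      rintro ⟨S, -, h2, h3⟩
      obtain ⟨x, hx⟩ := ne (by omega) h2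
      exact absurd (h3 x hx) (by omega))
    (by
      rintro ⟨S, -, h2, h3⟩
      obtain ⟨x, hx⟩ := ne (by omega) h2
      exact absurd (h3 x hx) (by omega))
  obtain ⟨b, ⟨D', hD', hDc', hDb⟩, ⟨I', hI', hIc', hIb⟩⟩ := switch
    (fun i => ∃ S, DecS σ S ∧ l - 1 ≤ S.card ∧ ∀ y ∈ S, (σ y : ℕ) < i)
    (fun i => ∃ S, IncS σ S ∧ k - 1 ≤ S.card ∧ ∀ y ∈ S, i ≤ (σ y : ℕ)) n
    (by
      intro i hin
      have hcov : ∀ x : Fin (n + 1), x ≠ 0 → ∃ y, Fin.succ y = x :=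
        fun x hx => Fin.exists_succ_eq.2 hx
      rcases hlft ⟨i, by omega⟩ with h | h
      · right
        obtain ⟨S, h1, h2, h3⟩ := ext_incr (σ := σ) Fin.succ Fin.strictMono_succ
          0 ⟨i, by omega⟩ hcov (by simp [leftExt]) (by simp [leftExt]) h hi
        exact ⟨S, h1, h2, fun y hy => (h3 y hy).2 (Fin.succ_pos y)⟩
      · left
        obtain ⟨S, h1, h2, h3⟩ := ext_decr (σ := σ) Fin.succ Fin.strictMono_succ
          0 ⟨i, by omega⟩ hcov (by simp [leftExt]) (by simp [leftExt]) h hd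
        exact ⟨S, h1, h2, fun y hy => (h3 y hy).1 (Fin.succ_pos y)⟩)
    (by
      rintro ⟨S, -, h2, h3⟩
      obtain ⟨x, hx⟩ := ne (by omega) h2
      exact absurd (h3 x hx) (by omega))
    (by
      rintro ⟨S, -, h2, h3⟩
      obtain ⟨x, hx⟩ := ne (by omega) h2
      exact absurd (h3 x hx) (by omega))
  by_cases hab : b < a
  · have hdis : Disjoint D D' := by
      rw [Finset.disjoint_left]
      intro x h1 h2
      have := hDa x h1
      have := hDb x h2
      omega
    have := three_card hdis (inter_card hI hD) (inter_card hI hD')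
    omega
  · have hdis : Disjoint I I' := by
      rw [Finset.disjoint_left]
      intro x h1 h2
      have e1 := hIa x h1
      have e2 := hIb x h2
      apply hi
      have hle : ∀ y ∈ I, y ≤ x := by
        intro y hy
        by_contra hc
        have := hI x h1 y hy (not_le.1 hc)
        have := hIa y hy
        omega
      have hge : ∀ y ∈ I', x ≤ y := by
        intro y hy
        by_contra hc
        have := hI' y hy x h2 (not_le.1 hc)
        have := hIb y hy
        omega
      have hinter : I ∩ I' ⊆ {x} := by
        intro y hy
        rw [Finset.mem_inter] at hy
        rw [Finset.mem_singleton]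
        exact le_antisymm (hle y hy.1) (hge y hy.2)
      refine hasIncr_of_set (S := I ∪ I') ?_ ?_
      · intro y hy z hz hyz
        rw [Finset.mem_union] at hy hz
        rcases hy with hy | hy <;> rcases hz with hz | hz
        · exact hI y hy z hz hyz
        · have f1 := hIa y hy
          have f2 := hIb z hz
          have f3 : σ y ≠ σ z := fun h => hyz.ne (hσ h)
          have f4 : (σ y : ℕ) ≠ σ z := fun h => f3 (Fin.ext h)
          show (σ y : ℕ) < σ z
          omega
        · exact absurd hyz (not_lt.2 ((hle z hz).trans (hge y hy)))
        · exact hI' y hy z hz hyz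
      · have h1 := Finset.card_union_add_card_inter I I'
        have h2 := Finset.card_le_card hinter
        rw [Finset.card_singleton] at h2
        omega
    have := three_card (C := D) hdis (by rw [Finset.inter_comm]; exact inter_card hI hD)
      (by rw [Finset.inter_comm]; exact inter_card hI' hD)
    omega

def qv (k l j : ℕ) : ℕ :=
  if j ≤ l - 2 then l - 2 - j else if j ≤ k + l - 5 then j else 2 * k + 3 * l - 10 - j

lemma minQuad_val (k l : ℕ) (hk : 3 ≤ k) (hl : 3 ≤ l) (j) :
    (minQuad k l hk hl j : ℕ) = qv k l j := by
  unfold minQuad qv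
  split_ifs <;> rfl

lemma succAbove_val {n : ℕ} (i : Fin (n + 1)) (x : Fin n) :
    (i.succAbove x : ℕ) = if (x : ℕ) < i then (x : ℕ) else x + 1 := by
  unfold Fin.succAbove
  simp only [Fin.lt_def, Fin.val_castSucc]
  split_ifs <;> simp

lemma right_val {n : ℕ} (σ : Fin n → Fin n) (w : ℕ → ℕ) (hw : ∀ j, (σ j : ℕ) = w j)
    (i p : Fin (n + 1)) : (rightExt σ i p : ℕ) =
      if (p : ℕ) < n then (if w p < i then w p else w p + 1) else i := by
  unfold rightExt
  induction p using Fin.lastCases with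
  | last => simp
  | cast y => simp [succAbove_val, hw]

lemma left_val {n : ℕ} (σ : Fin n → Fin n) (w : ℕ → ℕ) (hw : ∀ j, (σ j : ℕ) = w j)
    (i p : Fin (n + 1)) : (leftExt σ i p : ℕ) =
      if (p : ℕ) = 0 then (i : ℕ) else (if w (p - 1) < i then w (p - 1) else w (p - 1) + 1) := by
  unfold leftExt
  induction p using Fin.cases with
  | zero => simp
  | succ y => simp [succAbove_val, hw]

lemma top_val {n : ℕ} (σ : Fin n → Fin n) (w : ℕ → ℕ) (hw : ∀ j, (σ j : ℕ) = w j)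
    (i p : Fin (n + 1)) : (topExt σ i p : ℕ) =
      if (p : ℕ) < i then w p else if (p : ℕ) = i then n else w (p - 1) := by
  unfold topExt
  induction p using Fin.succAboveCases i with
  | x => simp
  | p y =>
    simp only [Fin.insertNth_apply_succAbove, Fin.val_castSucc, hw, succAbove_val]
    split_ifs <;> first | omega | rfl

lemma bot_val {n : ℕ} (σ : Fin n → Fin n) (w : ℕ → ℕ) (hw : ∀ j, (σ j : ℕ) = w j)
    (i p : Fin (n + 1)) : (botExt σ i p : ℕ) =
      if (p : ℕ) < i then w p + 1 else if (p : ℕ) = i then 0 else w (p - 1) + 1 := by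
  unfold botExt
  induction p using Fin.succAboveCases i with
  | x => simp
  | p y =>
    simp only [Fin.insertNth_apply_succAbove, Fin.val_succ, hw, succAbove_val]
    split_ifs <;> first | omega | rfl

lemma mkIncr {k n : ℕ} {τ : Fin n → Fin n} {w : ℕ → ℕ} (hw : ∀ p, (τ p : ℕ) = w p)
    (g : ℕ → ℕ) (hg : ∀ t < k, g t < n) 
    (h : ∀ s t A B, s < t → t < k → g s = A → g t = B → A < B ∧ w A < w B) :
    HasIncr k n τ := by
  refine ⟨fun t => ⟨g t, hg t t.2⟩, fun s t hst => (h s t _ _ hst t.2 rfl rfl).1, fun s t hst => ?_⟩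
  show (τ _ : ℕ) < τ _
  rw [hw, hw]
  exact (h s t _ _ hst t.2 rfl rfl).2

lemma mkDecr {k n : ℕ} {τ : Fin n → Fin n} {w : ℕ → ℕ} (hw : ∀ p, (τ p : ℕ) = w p)
    (g : ℕ → ℕ) (hg : ∀ t < k, g t < n) 
    (h : ∀ s t A B, s < t → t < k → g s = A → g t = B → A < B ∧ w B < w A) :
    HasDecr k n τ := by
  refine ⟨fun t => ⟨g t, hg t t.2⟩, fun s t hst => (h s t _ _ hst t.2 rfl rfl).1, fun s t hst => ?_⟩
  show (τ _ : ℕ) < τ _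
  rw [hw, hw]
  exact (h s t _ _ hst t.2 rfl rfl).2

lemma no_mono {k : ℕ} (hk : 1 ≤ k) (c : Fin k → ℕ) (h : StrictMono c) (hb : ∀ t, c t < k - 1) :
    False := by
  have := Finset.card_le_card_of_injOn (s := Finset.univ) (t := Finset.range (k - 1)) c
    (fun t _ => by simpa using hb t) h.injective.injOn
  simp at this
  omega

lemma avoids (k l : ℕ) (hk : 3 ≤ k) (hl : 3 ≤ l) :
    AvoidsPat k l (k + 2 * l - 5) (minQuad k l hk hl) := by
  constructor
  · rintro ⟨f, hf, hs⟩
    refine no_mono (by omega) (fun t => if (f t : ℕ) ≤ l - 2 then 0 else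
      if (f t : ℕ) ≤ k + l - 5 then f t - (l - 2) else k - 2) ?_ ?_
    · intro s t hst
      have h1 : (f s : ℕ) < f t := hf hst
      have h2 : (minQuad k l hk hl (f s) : ℕ) < minQuad k l hk hl (f t) := hs hst
      rw [minQuad_val, minQuad_val] at h2
      have h3 := (f t).2
      unfold qv at h2
      try dsimp only
      split_ifs at h2 ⊢ <;> omega
    · intro t
      try dsimp only
      split_ifs <;> omega
  · rintro ⟨f, hf, hs⟩
    refine no_mono (by omega) (fun t => if (f t : ℕ) ≤ l - 2 then (f t : ℕ) else
      if (f t : ℕ) ≤ k + l - 5 then 0 else f t - (k + l - 4)) ?_ ?_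
    · intro s t hst
      have h1 : (f s : ℕ) < f t := hf hst
      have h2 : (minQuad k l hk hl (f t) : ℕ) < minQuad k l hk hl (f s) := hs hst
      rw [minQuad_val, minQuad_val] at h2
      have h3 := (f t).2
      unfold qv at h2
      try dsimp only
      split_ifs at h2 ⊢ <;> omega
    · intro t
      have h3 := (f t).2
      try dsimp only
      split_ifs <;> omega

lemma min_right (k l : ℕ) (hk : 3 ≤ k) (hl : 3 ≤ l) (i : Fin (k + 2 * l - 5 + 1)) :
    ContainsPat k l (k + 2 * l - 5 + 1) (rightExt (minQuad k l hk hl) i) := by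
  have hw := right_val _ (qv k l) (minQuad_val k l hk hl) i
  have hi := i.2
  generalize (i : ℕ) = c at hw hi
  by_cases h : c ≤ k + l - 4
  · right
    refine mkDecr (w := fun p => if p < k + 2 * l - 5 then
      (if qv k l p < c then qv k l p else qv k l p + 1) else c) hw
      (fun t => k + l - 4 + t) (fun t ht => by omega) (fun s t A B hst ht hA hB => ?_)
    clear hw
    try dsimp only at hA
    try dsimp only at hB
    dsimp only [qv]
    try split_ifs at hA hB
    all_goals refine ⟨by omega, ?_⟩
    all_goals grind
  · left
    refine mkIncr (w := fun p => if p < k + 2 * l - 5 then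
      (if qv k l p < c then qv k l p else qv k l p + 1) else c) hw
      (fun t => if t ≤ k - 3 then l - 2 + t else if t = k - 2 then k + 2 * l - 6 else k + 2 * l - 5)
      (fun t ht => by split_ifs <;> omega) (fun s t A B hst ht hA hB => ?_)
    clear hw
    try dsimp only at hA
    try dsimp only at hB
    dsimp only [qv]
    try split_ifs at hA hB
    all_goals refine ⟨by omega, ?_⟩
    all_goals grind

lemma min_left (k l : ℕ) (hk : 3 ≤ k) (hl : 3 ≤ l) (i : Fin (k + 2 * l - 5 + 1)) :
    ContainsPat k l (k + 2 * l - 5 + 1) (leftExt (minQuad k l hk hl) i) := by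
  have hw := left_val _ (qv k l) (minQuad_val k l hk hl) i
  have hi := i.2
  generalize (i : ℕ) = c at hw hi
  by_cases h : l - 1 ≤ c
  · right
    refine mkDecr (w := fun p => if p = 0 then c else
      (if qv k l (p - 1) < c then qv k l (p - 1) else qv k l (p - 1) + 1)) hw
      (fun t => t) (fun t ht => by omega) (fun s t A B hst ht hA hB => ?_)
    clear hw
    try dsimp only at hA
    try dsimp only at hB
    dsimp only [qv]
    try split_ifs at hA hB
    all_goals refine ⟨by omega, ?_⟩
    all_goals grind
  · left
    refine mkIncr (w := fun p => if p = 0 then c else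
      (if qv k l (p - 1) < c then qv k l (p - 1) else qv k l (p - 1) + 1)) hw
      (fun t => if t ≤ 1 then t else l - 2 + t)
      (fun t ht => by split_ifs <;> omega) (fun s t A B hst ht hA hB => ?_)
    clear hw
    try dsimp only at hA
    try dsimp only at hB
    dsimp only [qv]
    try split_ifs at hA hB
    all_goals refine ⟨by omega, ?_⟩
    all_goals grind

lemma min_top (k l : ℕ) (hk : 3 ≤ k) (hl : 3 ≤ l) (i : Fin (k + 2 * l - 5 + 1)) :
    ContainsPat k l (k + 2 * l - 5 + 1) (topExt (minQuad k l hk hl) i) := by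
  have hw := top_val _ (qv k l) (minQuad_val k l hk hl) i
  have hi := i.2
  generalize (i : ℕ) = c at hw hi
  by_cases h : c ≤ k + l - 4
  · right
    refine mkDecr (w := fun p => if p < c then qv k l p else
      if p = c then k + 2 * l - 5 else qv k l (p - 1)) hw
      (fun t => if t = 0 then c else k + l - 4 + t)
      (fun t ht => by split_ifs <;> omega) (fun s t A B hst ht hA hB => ?_)
    clear hw
    try dsimp only at hA
    try dsimp only at hB
    dsimp only [qv]
    try split_ifs at hA hB
    all_goals refine ⟨by omega, ?_⟩
    all_goals grind
  · left
    refine mkIncr (w := fun p => if p < c then qv k l p else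
      if p = c then k + 2 * l - 5 else qv k l (p - 1)) hw
      (fun t => if t < k - 1 then l - 2 + t else c)
      (fun t ht => by split_ifs <;> omega) (fun s t A B hst ht hA hB => ?_)
    clear hw
    try dsimp only at hA
    try dsimp only at hB
    dsimp only [qv]
    try split_ifs at hA hB
    all_goals refine ⟨by omega, ?_⟩
    all_goals grind

lemma min_bot (k l : ℕ) (hk : 3 ≤ k) (hl : 3 ≤ l) (i : Fin (k + 2 * l - 5 + 1)) :
    ContainsPat k l (k + 2 * l - 5 + 1) (botExt (minQuad k l hk hl) i) := by
  have hw := bot_val _ (qv k l) (minQuad_val k l hk hl) i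
  have hi := i.2
  generalize (i : ℕ) = c at hw hi
  by_cases h : l - 1 ≤ c
  · right
    refine mkDecr (w := fun p => if p < c then qv k l p + 1 else
      if p = c then 0 else qv k l (p - 1) + 1) hw
      (fun t => if t < l - 1 then t else c)
      (fun t ht => by split_ifs <;> omega) (fun s t A B hst ht hA hB => ?_)
    clear hw
    try dsimp only at hA
    try dsimp only at hB
    dsimp only [qv]
    try split_ifs at hA hB
    all_goals refine ⟨by omega, ?_⟩
    all_goals grind
  · left
    refine mkIncr (w := fun p => if p < c then qv k l p + 1 else
      if p = c then 0 else qv k l (p - 1) + 1) hw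
      (fun t => if t = 0 then c else l - 2 + t)
      (fun t ht => by split_ifs <;> omega) (fun s t A B hst ht hA hB => ?_)
    clear hw
    try dsimp only at hA
    try dsimp only at hB
    dsimp only [qv]
    try split_ifs at hA hB
    all_goals refine ⟨by omega, ?_⟩
    all_goals grind

/-- minimal quadrocrucial permutations: for `k ≥ l ≥ 3`, every
`(k,l)`-quadrocrucial permutation has length at least `k+2l-5`, and the explicit permutation
`minQuad k l` of length `k+2l-5` is `(k,l)`-quadrocrucial; hence the minimal possible length
of a `(k,l)`-quadrocrucial permutation is `k+2l-5`. -/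
theorem minimal_quadrocrucial (k l : ℕ) (hl : 3 ≤ l) (hkl : l ≤ k) :
    (∀ (n : ℕ) (σ : Fin n → Fin n), Function.Bijective σ →
      Quadrocrucial k l n σ → k + 2 * l - 5 ≤ n) ∧
    Quadrocrucial k l (k + 2 * l - 5) (minQuad k l (hl.trans hkl) hl) := by
  refine ⟨fun n σ hσ h => lower k l hl hkl n σ hσ.injective h.1.1, ?_⟩
  have hk := hl.trans hkl
  have ha := avoids k l hk hl
  exact ⟨⟨⟨⟨ha, min_right k l hk hl⟩, ⟨ha, min_left k l hk hl⟩⟩, min_top k l hk hl⟩,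
    min_bot k l hk hl⟩
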